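/- CQ-conservativity for linear TGDs is undecidable: the set of (encodings of) tuples (T1, T2, ΣD, ΣQ), where T1, T2 are finite sets of linear TGDs and ΣD, ΣQ are finite schemas, such that T2 is ΣD,ΣQ-CQ-conservative over T1, is not computable. -/

import Mathlib

set_option autoImplicit false

/-! ### Terms: constants from 𝐂 (coded `Term.const n`) and nulls from 𝐍 (coded `Term.null n`) -/

inductive Term : Type
  | const : ℕ → Term
  | null  : ℕ → Term
deriving DecidableEq

def Term.isConst : Term → Prop
  | .const _ => True
  | .null _  => False

def termEquiv : Term ≃ ℕ ⊕ ℕ where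
  toFun t := match t with
    | .const n => Sum.inl n
    | .null n  => Sum.inr n
  invFun x := match x with
    | Sum.inl n => .const n
    | Sum.inr n => .null n
  left_inv t := by cases t <;> rfl
  right_inv x := by cases x <;> rfl

instance : Primcodable Term := Primcodable.ofEquiv _ termEquiv

/-! ### Relation symbols (with arity) and schemas -/

structure RelSym : Type where
  name : ℕ
  arity : ℕ
deriving DecidableEq

def relSymEquiv : RelSym ≃ ℕ × ℕ where
  toFun r := (r.name, r.arity)
  invFun p := ⟨p.1, p.2⟩
  left_inv r := rfl
  right_inv p := rfl

instance : Primcodable RelSym := Primcodable.ofEquiv _ relSymEquiv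

/-- A schema is a set of relation symbols. -/
abbrev Schema := Set RelSym

/-! ### Facts, instances, databases -/

structure Fct : Type where
  rel : RelSym
  args : List Term
deriving DecidableEq

def fctEquiv : Fct ≃ RelSym × List Term where
  toFun f := (f.rel, f.args)
  invFun p := ⟨p.1, p.2⟩
  left_inv f := rfl
  right_inv p := rfl

instance : Primcodable Fct := Primcodable.ofEquiv _ fctEquiv

/-- A fact is well-formed if its argument tuple matches the arity of its relation symbol
(arities are ≥ 1). -/
def Fct.wf (f : Fct) : Prop := f.args.length = f.rel.arity ∧ 1 ≤ f.rel.arity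

/-- An instance is a (possibly infinite) set of facts. -/
abbrev Inst := Set Fct

/-- The active domain of an instance. -/
def adom (I : Inst) : Set Term := { t | ∃ f ∈ I, t ∈ f.args }

/-- A database: a finite instance of well-formed facts using only constants from 𝐂. -/
def IsDB (I : Inst) : Prop :=
  I.Finite ∧ ∀ f ∈ I, f.wf ∧ ∀ t ∈ f.args, t.isConst

/-- `I` is a Σ-instance. -/
def InstOver (I : Inst) (S : Schema) : Prop := ∀ f ∈ I, f.rel ∈ S ∧ f.wf

/-- `I` is a Σ-database. -/
def IsDatabase (I : Inst) (S : Schema) : Prop := IsDB I ∧ ∀ f ∈ I, f.rel ∈ S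

/-! ### Homomorphisms -/

def Fct.map (h : Term → Term) (f : Fct) : Fct := ⟨f.rel, f.args.map h⟩

/-- `h` is a Σ-homomorphism from `I` to `J`. -/
def IsHomOn (S : Schema) (h : Term → Term) (I J : Inst) : Prop :=
  ∀ f ∈ I, f.rel ∈ S → f.map h ∈ J

/-- `h` is a homomorphism from `I` to `J` (all relation symbols). -/
def IsFullHom (h : Term → Term) (I J : Inst) : Prop := ∀ f ∈ I, f.map h ∈ J

/-- `h` is database-preserving: it is the identity on all constants from 𝐂. -/
def DBPres (h : Term → Term) : Prop := ∀ n : ℕ, h (Term.const n) = Term.const n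

/-- `I →_Σ J`: there is a database-preserving Σ-homomorphism from `I` to `J`. -/
def HomTo (S : Schema) (I J : Inst) : Prop := ∃ h, DBPres h ∧ IsHomOn S h I J

/-- The induced subinstance of `I` on a set `A` of terms. -/
def restrict (I : Inst) (A : Set Term) : Inst := { f | f ∈ I ∧ ∀ t ∈ f.args, t ∈ A }

/-- `I →ⁿ_Σ J`: every induced subinstance of `I` with at most `n` active-domain elements
admits a database-preserving Σ-homomorphism to `J`. -/
def HomN (S : Schema) (n : ℕ) (I J : Inst) : Prop :=
  ∀ A : Set Term, A ⊆ adom I → A.Finite → A.ncard ≤ n → HomTo S (restrict I A) J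

/-- `I →^lim_Σ J`. -/
def HomLim (S : Schema) (I J : Inst) : Prop := ∀ n : ℕ, 1 ≤ n → HomN S n I J

/-- Homomorphic equivalence of instances. -/
def HomEquiv (I J : Inst) : Prop := (∃ h, IsFullHom h I J) ∧ (∃ h, IsFullHom h J I)

/-! ### Gaifman graph and connectedness -/

def coOccur (I : Inst) (a b : Term) : Prop := ∃ f ∈ I, a ∈ f.args ∧ b ∈ f.args

/-- The Gaifman graph of `I` is connected. -/
def Connected (I : Inst) : Prop :=
  ∀ a ∈ adom I, ∀ b ∈ adom I, Relation.ReflTransGen (coOccur I) a b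

/-- Restriction `I|_Σ` of `I` to the facts using a relation symbol from Σ. -/
def restrS (I : Inst) (S : Schema) : Inst := { f | f ∈ I ∧ f.rel ∈ S }

/-- `I` is Σ-connected. -/
def SConnected (S : Schema) (I : Inst) : Prop := Connected (restrS I S)

/-- `C` is a maximally Σ-connected component of `I`. -/
def MaxConnComp (S : Schema) (I C : Inst) : Prop :=
  C ⊆ restrS I S ∧ Connected C ∧
    ∀ C', C ⊆ C' → C' ⊆ restrS I S → Connected C' → C' = C

/-! ### Conjunctive queries -/

structure Atom : Type where
  rel : RelSym
  args : List ℕ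
deriving DecidableEq

def atomEquiv : Atom ≃ RelSym × List ℕ where
  toFun a := (a.rel, a.args)
  invFun p := ⟨p.1, p.2⟩
  left_inv a := rfl
  right_inv p := rfl

instance : Primcodable Atom := Primcodable.ofEquiv _ atomEquiv

def Atom.wf (a : Atom) : Prop := a.args.length = a.rel.arity ∧ 1 ≤ a.rel.arity

/-- Instantiate an atom by an assignment of terms to variables. -/
def Atom.inst (h : ℕ → Term) (a : Atom) : Fct := ⟨a.rel, a.args.map h⟩

/-- A conjunctive query: a finite set of relational atoms (as a list) together with a
tuple of answer variables. -/
structure CQ : Type where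
  atoms : List Atom
  ans : List ℕ
deriving DecidableEq

def cqEquiv : CQ ≃ List Atom × List ℕ where
  toFun q := (q.atoms, q.ans)
  invFun p := ⟨p.1, p.2⟩
  left_inv q := rfl
  right_inv p := rfl

instance : Primcodable CQ := Primcodable.ofEquiv _ cqEquiv

/-- `q` is a CQ over schema Σ. -/
def CQ.Over (q : CQ) (S : Schema) : Prop := ∀ a ∈ q.atoms, a.rel ∈ S ∧ a.wf

/-- A homomorphism from `q` to `I`. -/
def CQHom (q : CQ) (I : Inst) (h : ℕ → Term) : Prop := ∀ a ∈ q.atoms, a.inst h ∈ I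

/-- `c̄` is an answer to `q` on `I`. -/
def IsAnswer (q : CQ) (I : Inst) (c : List Term) : Prop :=
  (∀ x ∈ c, x ∈ adom I) ∧ ∃ h, CQHom q I h ∧ q.ans.map h = c

/-- The canonical database of a CQ (variables viewed as constants/nulls). -/
def canonDB (q : CQ) : Inst := { f | ∃ a ∈ q.atoms, f = a.inst Term.null }

/-! ### Tuple-generating dependencies -/

/-- A TGD `∀x̄∀ȳ (φ(x̄,ȳ) → ∃z̄ ψ(x̄,z̄))`, with `frontier` the tuple `x̄` of
frontier variables. -/
structure TGD : Type where
  body : List Atom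
  head : List Atom
  frontier : List ℕ
deriving DecidableEq

def tgdEquiv : TGD ≃ List Atom × List Atom × List ℕ where
  toFun t := (t.body, t.head, t.frontier)
  invFun p := ⟨p.1, p.2.1, p.2.2⟩
  left_inv t := rfl
  right_inv p := rfl

instance : Primcodable TGD := Primcodable.ofEquiv _ tgdEquiv

def TGD.bodyVars (t : TGD) : Set ℕ := { x | ∃ a ∈ t.body, x ∈ a.args }
def TGD.headVars (t : TGD) : Set ℕ := { x | ∃ a ∈ t.head, x ∈ a.args }

/-- Well-formedness of a TGD: atoms are well-formed, the frontier variables are distinct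
body variables, and every variable shared by body and head is a frontier variable. -/
def TGD.wf (t : TGD) : Prop :=
  (∀ a ∈ t.body, a.wf) ∧ (∀ a ∈ t.head, a.wf) ∧ t.frontier.Nodup ∧
  (∀ x ∈ t.frontier, x ∈ t.bodyVars) ∧
  (∀ x, x ∈ t.bodyVars → x ∈ t.headVars → x ∈ t.frontier)

/-- A TGD is linear if its body contains at most one atom. -/
def TGD.Linear (t : TGD) : Prop := t.body.length ≤ 1

/-- A TGD is guarded if some body atom contains all body variables. -/
def TGD.Guarded (t : TGD) : Prop := ∃ a ∈ t.body, ∀ x, x ∈ t.bodyVars → x ∈ a.args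

/-- A TGD is frontier-one if it has exactly one frontier variable. -/
def TGD.FrontierOne (t : TGD) : Prop := t.frontier.length = 1

/-- `I ⊨ ϑ`. -/
def TGD.Satisfies (I : Inst) (t : TGD) : Prop :=
  ∀ g : ℕ → Term, (∀ a ∈ t.body, a.inst g ∈ I) →
    ∃ h : ℕ → Term, (∀ a ∈ t.head, a.inst h ∈ I) ∧ ∀ x ∈ t.frontier, h x = g x

/-- `I` is a model of the set `T` of TGDs. -/
def IsModel (I : Inst) (T : List TGD) : Prop := ∀ t ∈ T, TGD.Satisfies I t

/-- Number of (distinct) variables in the body of a TGD. -/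
def TGD.bodyVarList (t : TGD) : List ℕ := ((t.body.map Atom.args).flatten).dedup

/-- The body width of a set of TGDs. -/
def bodyWidth (T : List TGD) : ℕ := (T.map (fun t => t.bodyVarList.length)).foldr max 0

/-! ### The chase -/

/-- `ϑ` is applicable at tuple `c̄` in `I`. -/
def TGD.Applicable (t : TGD) (I : Inst) (c : List Term) : Prop :=
  (∃ g : ℕ → Term, (∀ a ∈ t.body, a.inst g ∈ I) ∧ t.frontier.map g = c) ∧
  ¬ (∃ h : ℕ → Term, (∀ a ∈ t.head, a.inst h ∈ I) ∧ t.frontier.map h = c)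

/-- `J` is the result of applying `ϑ` in `I` at `c̄`: the head is added, with the
existential variables replaced by distinct fresh nulls. -/
def TGD.StepResult (t : TGD) (I : Inst) (c : List Term) (J : Inst) : Prop :=
  ∃ h : ℕ → Term,
    t.frontier.map h = c ∧
    (∀ x, x ∈ t.headVars → x ∉ t.frontier → (¬ (h x).isConst ∧ h x ∉ adom I)) ∧
    (∀ x y, x ∈ t.headVars → y ∈ t.headVars → x ∉ t.frontier → y ∉ t.frontier →
      h x = h y → x = y) ∧
    J = I ∪ { f | ∃ a ∈ t.head, f = a.inst h }

/-- A chase step from `I` to `J` with some TGD of `T`. -/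
def ChaseStep (T : List TGD) (I J : Inst) : Prop :=
  ∃ t ∈ T, ∃ c, t.Applicable I c ∧ t.StepResult I c J

/-- A chase sequence for `I` with `T` (stalling when no TGD is applicable). -/
def IsChaseSeq (T : List TGD) (I : Inst) (f : ℕ → Inst) : Prop :=
  f 0 = I ∧ ∀ i, ChaseStep T (f i) (f (i+1)) ∨ ((¬ ∃ J, ChaseStep T (f i) J) ∧ f (i+1) = f i)

/-- Fairness: every applicable TGD application is eventually performed or becomes
non-applicable. -/
def IsFair (T : List TGD) (f : ℕ → Inst) : Prop :=
  ∀ i, ∀ t ∈ T, ∀ c, TGD.Applicable t (f i) c →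
    ∃ j, i ≤ j ∧
      ((TGD.Applicable t (f j) c ∧ TGD.StepResult t (f j) c (f (j+1))) ∨
        ¬ TGD.Applicable t (f j) c)

/-- `J` is the result of some fair chase sequence for `I` with `T`. -/
def IsChaseResult (T : List TGD) (I J : Inst) : Prop :=
  ∃ f : ℕ → Inst, IsChaseSeq T I f ∧ IsFair T f ∧ J = ⋃ i, f i

/-- `chase T I`: the result of an arbitrary but fixed fair chase sequence for `I` with `T`. -/
noncomputable def chase (T : List TGD) (I : Inst) : Inst :=
  @dite _ (∃ J, IsChaseResult T I J) (Classical.dec _) (fun h => h.choose) (fun _ => I)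

/-! ### Query answering w.r.t. TGDs and conservativity notions -/

/-- `c̄ ∈ q_T(D)`: `c̄` is a tuple over `adom D` and an answer to `q` on `chase T D`. -/
def AnswerWrt (q : CQ) (T : List TGD) (D : Inst) (c : List Term) : Prop :=
  (∀ x ∈ c, x ∈ adom D) ∧ ∃ h, CQHom q (chase T D) h ∧ q.ans.map h = c

/-- `T2` is `ΣD,ΣQ`-hom-conservative over `T1`. -/
def HomConservative (T1 T2 : List TGD) (SD SQ : Schema) : Prop :=
  ∀ D, IsDatabase D SD → HomTo SQ (chase T2 D) (chase T1 D)

/-- `T2` is `ΣD,ΣQ`-CQ-conservative over `T1`. -/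
def CQConservative (T1 T2 : List TGD) (SD SQ : Schema) : Prop :=
  ∀ D, IsDatabase D SD → ∀ q : CQ, CQ.Over q SQ →
    ∀ c, AnswerWrt q T2 D c → AnswerWrt q T1 D c

/-- `T` is `ΣD,ΣQ`-hom-trivial. -/
def HomTrivial (T : List TGD) (SD SQ : Schema) : Prop :=
  ∀ D, IsDatabase D SD → HomTo SQ (chase T D) D

/-- `T` is `ΣD,ΣQ`-CQ-trivial. -/
def CQTrivial (T : List TGD) (SD SQ : Schema) : Prop :=
  ∀ D, IsDatabase D SD → ∀ q : CQ, CQ.Over q SQ →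
    ∀ c, AnswerWrt q T D c → IsAnswer q D c

/-! ### Fair chase sequences -/

section Chase

theorem Set.Finite.adom {I : Inst} (hI : I.Finite) : (adom I).Finite := by
  have : _root_.adom I = ⋃ f ∈ I, {t | t ∈ f.args} := by
    ext t
    simp [_root_.adom]
  rw [this]
  exact hI.biUnion fun f _ => f.args.finite_toSet

theorem TGD.exists_stepResult (t : TGD) {I : Inst} (hI : I.Finite) {c : List Term}
    (hc : t.Applicable I c) : ∃ J, t.StepResult I c J ∧ J.Finite := by
  classical
  obtain ⟨⟨g, -, hg⟩, -⟩ := hc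
  have hfin : {n | Term.null n ∈ adom I}.Finite :=
    hI.adom.preimage (fun a _ b _ h => by simpa using h)
  obtain ⟨N, hN⟩ := hfin.bddAbove
  refine ⟨_, ⟨fun x => if x ∈ t.frontier then g x else Term.null (N + 1 + x), ?_, ?_, ?_, rfl⟩, ?_⟩
  · rw [← hg]
    exact List.map_congr_left fun x hx => by simp [hx]
  · intro x _ hx
    simp only [hx, if_false]
    refine ⟨fun h => h, fun h => ?_⟩
    have := hN (show _ ∈ {n | Term.null n ∈ adom I} from h)
    omega
  · intro x y _ _ hx hy h
    simp only [hx, hy, if_false, Term.null.injEq] at h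
    omega
  · refine hI.union ?_
    have : {f | ∃ a ∈ t.head, f = a.inst fun x =>
        if x ∈ t.frontier then g x else Term.null (N + 1 + x)} =
        (fun a : Atom => a.inst fun x =>
          if x ∈ t.frontier then g x else Term.null (N + 1 + x)) '' {a | a ∈ t.head} := by
      ext f
      simp [eq_comm]
    rw [this]
    exact t.head.finite_toSet.image _

theorem TGD.StepResult.subset {t : TGD} {I J : Inst} {c : List Term} (h : t.StepResult I c J) :
    I ⊆ J := by
  obtain ⟨h, -, -, -, rfl⟩ := h
  exact Set.subset_union_left

theorem TGD.StepResult.exists_head {t : TGD} {I J : Inst} {c : List Term}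
    (h : t.StepResult I c J) :
    ∃ h : ℕ → Term, (∀ a ∈ t.head, a.inst h ∈ J) ∧ t.frontier.map h = c := by
  obtain ⟨h, hc, -, -, rfl⟩ := h
  exact ⟨h, fun a ha => Or.inr ⟨a, ha, rfl⟩, hc⟩

theorem TGD.StepResult.not_applicable {t : TGD} {I J J' : Inst} {c : List Term}
    (h : t.StepResult I c J) (hJ : J ⊆ J') : ¬ t.Applicable J' c := by
  obtain ⟨h, hh, hc⟩ := h.exists_head
  exact fun ha => ha.2 ⟨h, fun a h' => hJ (hh a h'), hc⟩

/-- Among all applicable pairs of a TGD and a tuple, the one with the least code is applied. -/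
def MinimalStep (T : List TGD) (I J : Inst) (p : TGD × List Term) : Prop :=
  p.1 ∈ T ∧ p.1.Applicable I p.2 ∧ p.1.StepResult I p.2 J ∧
    ∀ p' : TGD × List Term, p'.1 ∈ T → p'.1.Applicable I p'.2 →
      Encodable.encode p ≤ Encodable.encode p'

theorem exists_minimalStep (T : List TGD) {I : Inst} (hI : I.Finite) :
    ∃ J : Inst, J.Finite ∧ ((∃ p, MinimalStep T I J p) ∨
      ((∀ t ∈ T, ∀ c, ¬ t.Applicable I c) ∧ J = I)) := by
  classical
  by_cases h : ∃ n, ∃ p : TGD × List Term,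
      Encodable.encode p = n ∧ p.1 ∈ T ∧ p.1.Applicable I p.2
  · obtain ⟨p, hp, hT, ha⟩ := Nat.find_spec h
    obtain ⟨J, hJ, hfin⟩ := p.1.exists_stepResult hI ha
    refine ⟨J, hfin, Or.inl ⟨p, hT, ha, hJ, fun p' hT' ha' => ?_⟩⟩
    rw [hp]
    exact Nat.find_min' h ⟨p', rfl, hT', ha'⟩
  · refine ⟨I, hI, Or.inr ⟨fun t ht c hc => h ⟨_, (t, c), rfl, ht, hc⟩, rfl⟩⟩

theorem exists_chaseResult (T : List TGD) {D : Inst} (hD : D.Finite) :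
    ∃ J, IsChaseResult T D J := by
  choose next hnext using fun I : {I : Inst // I.Finite} => exists_minimalStep T I.2
  let f : ℕ → {I : Inst // I.Finite} := fun n =>
    Nat.rec ⟨D, hD⟩ (fun _ I => ⟨next I, (hnext I).1⟩) n
  have hf : ∀ i, (∃ p, MinimalStep T (f i).1 (f (i + 1)).1 p) ∨
      ((∀ t ∈ T, ∀ c, ¬ t.Applicable (f i).1 c) ∧ (f (i + 1)).1 = (f i).1) :=
    fun i => (hnext (f i)).2
  have hmono : Monotone fun i => (f i).1 := by
    refine monotone_nat_of_le_succ fun i => ?_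
    rcases hf i with ⟨p, -, -, h, -⟩ | ⟨-, h⟩
    · exact h.subset
    · exact h.ge
  refine ⟨_, fun i => (f i).1, ⟨rfl, fun i => ?_⟩, ?_, rfl⟩
  · rcases hf i with ⟨p, hT, ha, h, -⟩ | ⟨hn, h⟩
    · exact Or.inl ⟨p.1, hT, p.2, ha, h⟩
    · refine Or.inr ⟨?_, h⟩
      rintro ⟨J, t, ht, c, hc, -⟩
      exact hn t ht c hc
  · intro i t ht c _
    by_contra! hcon
    have happ : ∀ j, i ≤ j → t.Applicable (f j).1 c := fun j hj => (hcon j hj).2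
    have hp : ∀ j, ∃ p, MinimalStep T (f (i + j)).1 (f (i + j + 1)).1 p := fun j =>
      (hf (i + j)).resolve_right fun h => h.1 t ht c (happ _ (Nat.le_add_right _ _))
    choose p hp using hp
    have hinj : Function.Injective fun j =>
        (⟨Encodable.encode (p j), Nat.lt_succ_of_le
          ((hp j).2.2.2 (t, c) ht (happ _ (Nat.le_add_right _ _)))⟩ :
          Fin (Encodable.encode (t, c) + 1)) := by
      have key : ∀ a b, a < b → p a ≠ p b := by
        intro a b hab he
        have h1 := (hp a).2.2.1.not_applicable (hmono (show i + a + 1 ≤ i + b by omega))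
        rw [he] at h1
        exact h1 (hp b).2.1
      intro a b hab
      have hab : p a = p b := Encodable.encode_injective (congrArg Fin.val hab)
      rcases lt_trichotomy a b with h | h | h
      · exact absurd hab (key a b h)
      · exact h
      · exact absurd hab.symm (key b a h)
    exact not_injective_infinite_finite _ hinj

theorem isChaseResult_chase (T : List TGD) {D : Inst} (hD : D.Finite) :
    IsChaseResult T D (chase T D) := by
  rw [chase, dif_pos (exists_chaseResult T hD)]
  exact (exists_chaseResult T hD).choose_spec

theorem IsChaseSeq.monotone {T : List TGD} {D : Inst} {f : ℕ → Inst} (hf : IsChaseSeq T D f) :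
    Monotone f := by
  refine monotone_nat_of_le_succ fun i => ?_
  rcases hf.2 i with ⟨t, -, c, -, h⟩ | ⟨-, h⟩
  · exact h.subset
  · exact h.ge

theorem exists_forall_mem_of_mem_iUnion {α : Type*} {f : ℕ → Inst} (hf : Monotone f)
    (l : List α) (φ : α → Fct) (h : ∀ a ∈ l, φ a ∈ ⋃ i, f i) : ∃ i, ∀ a ∈ l, φ a ∈ f i := by
  induction l with
  | nil => exact ⟨0, by simp⟩
  | cons a l ih =>
    obtain ⟨i, hi⟩ := ih fun b hb => h b (List.mem_cons_of_mem _ hb)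
    obtain ⟨j, hj⟩ := Set.mem_iUnion.1 (h a List.mem_cons_self)
    refine ⟨max i j, fun b hb => ?_⟩
    rcases List.mem_cons.1 hb with rfl | hb
    · exact hf (le_max_right i j) hj
    · exact hf (le_max_left i j) (hi b hb)

/-- The chase of a finite instance is a model. -/
theorem isModel_chase (T : List TGD) {D : Inst} (hD : D.Finite) : IsModel (chase T D) T := by
  obtain ⟨f, hseq, hfair, hJ⟩ := isChaseResult_chase T hD
  rw [hJ]
  intro t ht g hg
  obtain ⟨i, hi⟩ := exists_forall_mem_of_mem_iUnion hseq.monotone t.body (fun a => a.inst g) hg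
  suffices ∃ h : ℕ → Term, (∀ a ∈ t.head, a.inst h ∈ ⋃ i, f i) ∧
      t.frontier.map h = t.frontier.map g by
    obtain ⟨h, hh, he⟩ := this
    exact ⟨h, hh, fun x hx => List.map_inj_left.1 he x hx⟩
  have key : ∀ j, i ≤ j → ¬ t.Applicable (f j) (t.frontier.map g) →
      ∃ h : ℕ → Term, (∀ a ∈ t.head, a.inst h ∈ ⋃ i, f i) ∧
        t.frontier.map h = t.frontier.map g := by
    intro j hij hn
    by_contra hcon
    refine hn ⟨⟨g, fun a ha => hseq.monotone hij (hi a ha), rfl⟩, fun ⟨h, hh, he⟩ => hcon ?_⟩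
    exact ⟨h, fun a ha => Set.mem_iUnion.2 ⟨j, hh a ha⟩, he⟩
  by_cases ha : t.Applicable (f i) (t.frontier.map g)
  · obtain ⟨j, hij, ⟨-, hs⟩ | hn⟩ := hfair i t ht _ ha
    · obtain ⟨h, hh, he⟩ := hs.exists_head
      exact ⟨h, fun a ha => Set.mem_iUnion.2 ⟨j + 1, hh a ha⟩, he⟩
    · exact key j hij hn
  · exact key i le_rfl ha

theorem Atom.inst_map (a : Atom) (g : ℕ → Term) (h : Term → Term) :
    (a.inst g).map h = a.inst (h ∘ g) := by
  simp [Atom.inst, Fct.map]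

theorem Atom.inst_congr (a : Atom) {g h : ℕ → Term} (H : ∀ x ∈ a.args, g x = h x) :
    a.inst g = a.inst h := by
  simp only [Atom.inst, Fct.mk.injEq, true_and]
  exact List.map_congr_left H

theorem IsFullHom.exists_stepResult {t : TGD} (hwf : t.wf) {I J M : Inst} {c : List Term}
    (hM : TGD.Satisfies M t) {h : Term → Term} (hh : IsFullHom h I M)
    (ha : t.Applicable I c) (hs : t.StepResult I c J) : ∃ h', IsFullHom h' J M := by
  classical
  obtain ⟨⟨g, hg, hgc⟩, -⟩ := ha
  obtain ⟨e, hec, hfresh, hinj, rfl⟩ := hs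
  obtain ⟨k, hk, hkg⟩ := hM (h ∘ g) fun a ha => by
    rw [← Atom.inst_map]
    exact hh _ (hg a ha)
  let h' : Term → Term := fun τ =>
    if τ ∈ adom I then h τ
    else if H : ∃ x, x ∈ t.headVars ∧ x ∉ t.frontier ∧ e x = τ then k H.choose else h τ
  have hI : ∀ τ ∈ adom I, h' τ = h τ := fun τ hτ => by simp [h', hτ]
  refine ⟨h', ?_⟩
  rintro f (hf | ⟨a, ha, rfl⟩)
  · have : f.map h' = f.map h := by
      simp only [Fct.map, Fct.mk.injEq, true_and]
      exact List.map_congr_left fun τ hτ => hI τ ⟨f, hf, hτ⟩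
    rw [this]
    exact hh f hf
  · rw [Atom.inst_map, Atom.inst_congr a (h := k)]
    · exact hk a ha
    · intro x hx
      have hxv : x ∈ t.headVars := ⟨a, ha, hx⟩
      by_cases hxf : x ∈ t.frontier
      · have hex : e x = g x := List.map_inj_left.1 (hec.trans hgc.symm) x hxf
        obtain ⟨b, hb, hxb⟩ := hwf.2.2.2.1 x hxf
        have : g x ∈ adom I := ⟨_, hg b hb, List.mem_map_of_mem hxb⟩
        rw [hkg x hxf, Function.comp_apply, hex, hI _ this, Function.comp_apply]
      · have H : ∃ y, y ∈ t.headVars ∧ y ∉ t.frontier ∧ e y = e x := ⟨x, hxv, hxf, rfl⟩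
        have h1 := (hfresh x hxv hxf).2
        obtain ⟨h2, h3, h4⟩ := H.choose_spec
        have h5 := hinj _ _ h2 hxv h3 hxf h4
        simp only [h', Function.comp_apply, h1, if_false, dif_pos H]
        rw [h5]

/-- Every conjunctive query that matches in the chase matches in every model. -/
theorem CQHom.of_chase {T : List TGD} (hT : ∀ t ∈ T, t.wf) {D M : Inst} (hD : D.Finite)
    (hDM : D ⊆ M) (hM : IsModel M T) {q : CQ} {g : ℕ → Term} (hg : CQHom q (chase T D) g) :
    ∃ h : Term → Term, CQHom q M (h ∘ g) := by
  obtain ⟨f, hseq, -, hJ⟩ := isChaseResult_chase T hD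
  have hom : ∀ i, ∃ h, IsFullHom h (f i) M := by
    intro i
    induction i with
    | zero =>
      refine ⟨id, fun a ha => ?_⟩
      rw [hseq.1] at ha
      simpa [Fct.map] using hDM ha
    | succ i ih =>
      obtain ⟨h, hh⟩ := ih
      rcases hseq.2 i with ⟨t, ht, c, ha, hs⟩ | ⟨-, he⟩
      · exact hh.exists_stepResult (hT t ht) (hM t ht) ha hs
      · rw [he]
        exact ⟨h, hh⟩
  obtain ⟨i, hi⟩ := exists_forall_mem_of_mem_iUnion hseq.monotone q.atoms (fun a => a.inst g)
    (fun a ha => hJ ▸ hg a ha)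
  obtain ⟨h, hh⟩ := hom i
  refine ⟨h, fun a ha => ?_⟩
  rw [← Atom.inst_map]
  exact hh _ (hi a ha)

end Chase

/-! ### Ladders and runs of a queue program -/

section Ladder

def relS : RelSym := ⟨0, 2⟩
def relE : RelSym := ⟨1, 3⟩
def relF : RelSym := ⟨2, 3⟩
def relL : RelSym := ⟨3, 2⟩
def relP (s : ℕ) : RelSym := ⟨s + 4, 7⟩

/-- Instructions of a program that reads one word and writes another over a five-letter
alphabet; control states are natural numbers. -/
inductive Instr : Type
  | halt (s : ℕ) : Instr
  | read (s : ℕ) (a : Fin 5) (s' : ℕ) : Instr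
  | write (s : ℕ) (a : Fin 5) (s' : ℕ) : Instr

/-- `Gen p s u v`: from state `s`, the program `p` can read `u` while writing `v` and then halt. -/
inductive Gen (p : List Instr) : ℕ → List (Fin 5) → List (Fin 5) → Prop
  | halt {s} : Instr.halt s ∈ p → Gen p s [] []
  | read {s a s' u v} : Instr.read s a s' ∈ p → Gen p s' u v → Gen p s (a :: u) v
  | write {s a s' u v} : Instr.write s a s' ∈ p → Gen p s' u v → Gen p s u (a :: v)

/-- An atom `P_s` holds the five letters followed by the current nodes of both words. The
words are generated from their last letter to their first. -/
def Instr.tgd : Instr → TGD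
  | .halt s => ⟨[], [⟨relP s, [0, 1, 2, 3, 4, 5, 6]⟩], []⟩
  | .read s a s' => ⟨[⟨relP s', [0, 1, 2, 3, 4, 5, 6]⟩],
      [⟨relE, [7, a, 5]⟩, ⟨relP s, [0, 1, 2, 3, 4, 7, 6]⟩], [0, 1, 2, 3, 4, 5, 6]⟩
  | .write s a s' => ⟨[⟨relP s', [0, 1, 2, 3, 4, 5, 6]⟩],
      [⟨relF, [7, a, 6]⟩, ⟨relP s, [0, 1, 2, 3, 4, 5, 7]⟩], [0, 1, 2, 3, 4, 5, 6]⟩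

def startTGD (s : ℕ) : TGD := ⟨[⟨relP s, [0, 1, 2, 3, 4, 5, 6]⟩], [⟨relS, [5, 6]⟩], [5, 6]⟩

def genTGDs (p : List Instr) (s : ℕ) : List TGD := startTGD s :: p.map Instr.tgd

def ladderTGDs : List TGD :=
  [⟨[], [⟨relS, [0, 1]⟩, ⟨relL, [0, 1]⟩], []⟩,
   ⟨[⟨relL, [0, 1]⟩], [⟨relE, [0, 2, 3]⟩, ⟨relF, [1, 2, 4]⟩, ⟨relL, [3, 4]⟩], [0, 1]⟩]

def querySchema : List RelSym := [relS, relE, relF]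

theorem Instr.tgd_wf_linear (i : Instr) : i.tgd.wf ∧ i.tgd.Linear := by
  cases i with
  | halt s =>
    simp [Instr.tgd, TGD.wf, TGD.Linear, Atom.wf, TGD.bodyVars, relP]
  | read s a s' =>
    fin_cases a <;>
    simp +contextual [Instr.tgd, TGD.wf, TGD.Linear, Atom.wf, TGD.bodyVars, TGD.headVars, relP, relE]
  | write s a s' =>
    fin_cases a <;>
    simp +contextual [Instr.tgd, TGD.wf, TGD.Linear, Atom.wf, TGD.bodyVars, TGD.headVars, relP, relF]

theorem genTGDs_wf_linear (p : List Instr) (s : ℕ) : ∀ t ∈ genTGDs p s, t.wf ∧ t.Linear := by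
  intro t ht
  rcases List.mem_cons.1 ht with rfl | ht
  · simp +contextual [startTGD, TGD.wf, TGD.Linear, Atom.wf, TGD.bodyVars, TGD.headVars, relP, relS]
  · obtain ⟨i, -, rfl⟩ := List.mem_map.1 ht
    exact i.tgd_wf_linear

theorem ladderTGDs_wf_linear : ∀ t ∈ ladderTGDs, t.wf ∧ t.Linear := by
  simp +contextual [ladderTGDs, TGD.wf, TGD.Linear, Atom.wf, TGD.bodyVars, TGD.headVars, relS, relE,
    relF, relL]

/-- The `i`-th rung of the ladder described by `h`: two edges carrying the same letter. -/
def Rung (J : Inst) (h : ℕ → Term) (i : ℕ) : Prop :=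
  ⟨relE, [h (3 * i), h (3 * i + 2), h (3 * i + 3)]⟩ ∈ J ∧
    ⟨relF, [h (3 * i + 1), h (3 * i + 2), h (3 * i + 4)]⟩ ∈ J

/-- `h` is a ladder with `n` rungs in `J`. -/
def IsLadder (J : Inst) (n : ℕ) (h : ℕ → Term) : Prop :=
  ⟨relS, [h 0, h 1]⟩ ∈ J ∧ ∀ i < n, Rung J h i

/-- The ladder with `n` rungs as a Boolean conjunctive query. -/
def ladderCQ (n : ℕ) : CQ :=
  ⟨⟨relS, [0, 1]⟩ :: ((List.range n).map (fun i => ⟨relE, [3 * i, 3 * i + 2, 3 * i + 3]⟩) ++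
    (List.range n).map (fun i => ⟨relF, [3 * i + 1, 3 * i + 2, 3 * i + 4]⟩)), []⟩

theorem cqHom_ladderCQ {J : Inst} {n : ℕ} {h : ℕ → Term} :
    CQHom (ladderCQ n) J h ↔ IsLadder J n h := by
  simp only [CQHom, ladderCQ, IsLadder, Rung, List.mem_cons, List.mem_append, List.mem_map,
    List.mem_range, Atom.inst]
  constructor
  · intro H
    refine ⟨by simpa using H _ (Or.inl rfl), fun i hi => ⟨?_, ?_⟩⟩
    · simpa using H _ (Or.inr (Or.inl ⟨i, hi, rfl⟩))
    · simpa using H _ (Or.inr (Or.inr ⟨i, hi, rfl⟩))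
  · rintro ⟨h0, H⟩ a (rfl | ⟨i, hi, rfl⟩ | ⟨i, hi, rfl⟩)
    · simpa using h0
    · simpa using (H i hi).1
    · simpa using (H i hi).2

theorem ladderCQ_over (n : ℕ) : (ladderCQ n).Over {r | r ∈ querySchema} := by
  simp only [CQ.Over, ladderCQ, querySchema, List.mem_cons, List.mem_append, List.mem_map,
    List.mem_range]
  rintro a (rfl | ⟨i, hi, rfl⟩ | ⟨i, hi, rfl⟩) <;> simp [Atom.wf, relS, relE, relF]

/-- Prepend a rung to a ladder. -/
def consRung (x y l : Term) (h : ℕ → Term) : ℕ → Term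
  | 0 => x
  | 1 => y
  | 2 => l
  | i + 3 => h i

theorem rung_consRung {J : Inst} {x y l : Term} {h : ℕ → Term} {n : ℕ}
    (hE : ⟨relE, [x, l, h 0]⟩ ∈ J) (hF : ⟨relF, [y, l, h 1]⟩ ∈ J) (hh : ∀ i < n, Rung J h i) :
    ∀ i < n + 1, Rung J (consRung x y l h) i := by
  intro i hi
  cases i with
  | zero => exact ⟨hE, hF⟩
  | succ i => exact hh i (by omega)

theorem exists_isLadder_of_isModel_ladderTGDs {J : Inst} (hJ : IsModel J ladderTGDs) (n : ℕ) :
    ∃ h, IsLadder J n h := by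
  have key : ∀ n x y, ⟨relL, [x, y]⟩ ∈ J → ∃ h : ℕ → Term, h 0 = x ∧ h 1 = y ∧
      ∀ i < n, Rung J h i := by
    intro n
    induction n with
    | zero =>
      intro x y _
      exact ⟨consRung x y x fun _ => x, rfl, rfl, by simp⟩
    | succ n ih =>
      intro x y hxy
      obtain ⟨g, hg, hfr⟩ := hJ _ (List.mem_cons_of_mem _ List.mem_cons_self)
        (consRung x y x fun _ => x) (by simpa [Atom.inst, consRung] using hxy)
      simp only [List.mem_cons, List.not_mem_nil, or_false, forall_eq_or_imp, forall_eq,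
        Atom.inst, List.map_cons, List.map_nil] at hg hfr
      rw [hfr.1, hfr.2] at hg
      obtain ⟨h, h0, h1, hh⟩ := ih _ _ hg.2.2
      exact ⟨consRung x y (g 2) h, rfl, rfl, rung_consRung (h0 ▸ hg.1) (h1 ▸ hg.2.1) hh⟩
  obtain ⟨g, hg, -⟩ := hJ _ List.mem_cons_self (fun _ => Term.null 0) (by simp)
  simp only [List.mem_cons, List.not_mem_nil, or_false, forall_eq_or_imp, forall_eq,
    Atom.inst, List.map_cons, List.map_nil] at hg
  obtain ⟨h, h0, h1, hh⟩ := key n _ _ hg.2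
  exact ⟨h, h0 ▸ h1 ▸ hg.1, hh⟩

/-- The infinite ladder. -/
def ladderInst : Inst :=
  {f | f = ⟨relS, [.null 0, .null 1]⟩ ∨ ∃ i,
    f = ⟨relE, [.null (3 * i), .null (3 * i + 2), .null (3 * i + 3)]⟩ ∨
    f = ⟨relF, [.null (3 * i + 1), .null (3 * i + 2), .null (3 * i + 4)]⟩ ∨
    f = ⟨relL, [.null (3 * i), .null (3 * i + 1)]⟩}

theorem isModel_ladderInst : IsModel ladderInst ladderTGDs := by
  simp only [IsModel, ladderTGDs, List.mem_cons, List.not_mem_nil, or_false, forall_eq_or_imp,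
    forall_eq]
  constructor
  · intro g _
    refine ⟨Term.null, ?_, by simp⟩
    simp only [List.mem_cons, List.not_mem_nil, or_false, forall_eq_or_imp, forall_eq]
    exact ⟨Or.inl rfl, Or.inr ⟨0, Or.inr (Or.inr rfl)⟩⟩
  · intro g hg
    have hL := hg _ List.mem_cons_self
    rcases hL with h | ⟨i, h | h | h⟩
    · exact absurd h (by simp [Atom.inst, relL, relS])
    · exact absurd h (by simp [Atom.inst, relL, relE])
    · exact absurd h (by simp [Atom.inst, relL, relF])
    · simp only [Atom.inst, List.map_cons, List.map_nil, Fct.mk.injEq, List.cons.injEq, and_true,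
        true_and] at h
      let k : ℕ → Term
        | 0 => .null (3 * i)
        | 1 => .null (3 * i + 1)
        | 2 => .null (3 * i + 2)
        | 3 => .null (3 * i + 3)
        | _ => .null (3 * i + 4)
      refine ⟨k, ?_, by simp [k, h.1, h.2]⟩
      simp only [List.mem_cons, List.not_mem_nil, or_false, forall_eq_or_imp, forall_eq]
      exact ⟨Or.inr ⟨i, Or.inl rfl⟩, Or.inr ⟨i, Or.inr (Or.inl rfl)⟩,
        Or.inr ⟨i + 1, Or.inr (Or.inr rfl)⟩⟩

/-- Substitute terms for nulls. -/
def nullSubst (h : ℕ → Term) : Term → Term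
  | .null i => h i
  | .const i => .const i

/-- A finite query over the ladder relations that matches in the infinite ladder matches in every
instance with arbitrarily long ladders. -/
theorem exists_cqHom_of_ladderInst {q : CQ} (hq : q.Over {r | r ∈ querySchema}) {g : ℕ → Term}
    (hg : CQHom q ladderInst g) {J : Inst} (hJ : ∀ n, ∃ h, IsLadder J n h) :
    ∃ h, CQHom q J h := by
  have key : ∀ l : List Atom, (∀ a ∈ l, a.rel ∈ querySchema ∧ a.inst g ∈ ladderInst) →
      ∃ n, ∀ h, IsLadder J n h → ∀ a ∈ l,
        (a.inst g).map (nullSubst h) ∈ J := by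
    intro l
    induction l with
    | nil => simp
    | cons a l ih =>
      intro hl
      obtain ⟨n, hn⟩ := ih fun b hb => hl b (List.mem_cons_of_mem _ hb)
      obtain ⟨har, ha⟩ := hl a List.mem_cons_self
      have hra : (a.inst g).rel ∈ querySchema := har
      suffices ∃ m, ∀ h, IsLadder J m h →
          (a.inst g).map (nullSubst h) ∈ J by
        obtain ⟨m, hm⟩ := this
        refine ⟨max n m, fun h hh b hb => ?_⟩
        rcases List.mem_cons.1 hb with rfl | hb
        · exact hm h ⟨hh.1, fun i hi => hh.2 i (lt_of_lt_of_le hi (le_max_right _ _))⟩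
        · exact hn h ⟨hh.1, fun i hi => hh.2 i (lt_of_lt_of_le hi (le_max_left _ _))⟩ b hb
      rcases ha with h | ⟨i, h | h | h⟩
      · rw [h]
        exact ⟨0, fun h hh => hh.1⟩
      · rw [h]
        exact ⟨i + 1, fun h hh => (hh.2 i (Nat.lt_succ_self i)).1⟩
      · rw [h]
        exact ⟨i + 1, fun h hh => (hh.2 i (Nat.lt_succ_self i)).2⟩
      · rw [h] at hra
        simp [querySchema, relL, relS, relE, relF] at hra
  obtain ⟨n, hn⟩ := key q.atoms fun a ha => ⟨(hq a ha).1, hg a ha⟩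
  obtain ⟨h, hh⟩ := hJ n
  refine ⟨nullSubst h ∘ g, fun a ha => ?_⟩
  rw [← Atom.inst_map]
  exact hn h hh a ha

/-- With the empty data schema, conservativity of the ladder amounts to the existence of
arbitrarily long finite ladders. -/
theorem cqConservative_ladderTGDs_iff {T : List TGD} :
    CQConservative T ladderTGDs {r | r ∈ ([] : List RelSym)} {r | r ∈ querySchema} ↔
      ∀ n, ∃ h, IsLadder (chase T ∅) n h := by
  constructor
  · intro H n
    obtain ⟨h, hh⟩ := exists_isLadder_of_isModel_ladderTGDs
      (isModel_chase ladderTGDs Set.finite_empty) n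
    obtain ⟨-, h', hh', -⟩ := H ∅ ⟨⟨Set.finite_empty, by simp⟩, by simp⟩ (ladderCQ n)
      (ladderCQ_over n) [] ⟨by simp, h, cqHom_ladderCQ.2 hh, rfl⟩
    exact ⟨h', cqHom_ladderCQ.1 hh'⟩
  · rintro H D hD q hq c ⟨hc, h, hh, hans⟩
    obtain rfl : D = ∅ := Set.eq_empty_of_forall_notMem fun f hf => by simpa using hD.2 f hf
    obtain rfl : c = [] := List.eq_nil_iff_forall_not_mem.2 fun x hx => by
      obtain ⟨f, hf, -⟩ := hc x hx
      exact hf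
    obtain ⟨g, hg⟩ := hh.of_chase (fun t ht => (ladderTGDs_wf_linear t ht).1) Set.finite_empty
      (Set.empty_subset _) isModel_ladderInst
    obtain ⟨k, hk⟩ := exists_cqHom_of_ladderInst hq hg H
    exact ⟨by simp, k, hk, by simpa using hans⟩

/-! The instance of all generated pairs of words. -/

def letterTerm (a : Fin 5) : Term := .null (2 * a + 1)

def wordTerm (w : List (Fin 5)) : Term := .null (2 * Encodable.encode w)

theorem letterTerm_inj {a b : Fin 5} (h : letterTerm a = letterTerm b) : a = b := by
  simp only [letterTerm, Term.null.injEq] at h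
  omega

theorem wordTerm_inj {u v : List (Fin 5)} (h : wordTerm u = wordTerm v) : u = v := by
  simp only [wordTerm, Term.null.injEq] at h
  exact Encodable.encode_injective (by omega)

def stateArgs (u v : List (Fin 5)) : List Term :=
  [letterTerm 0, letterTerm 1, letterTerm 2, letterTerm 3, letterTerm 4, wordTerm u, wordTerm v]

def genInst (p : List Instr) (s₀ : ℕ) : Inst :=
  {f | (∃ u v, Gen p s₀ u v ∧ f = ⟨relS, [wordTerm u, wordTerm v]⟩) ∨
    (∃ a u, f = ⟨relE, [wordTerm (a :: u), letterTerm a, wordTerm u]⟩) ∨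
    (∃ a u, f = ⟨relF, [wordTerm (a :: u), letterTerm a, wordTerm u]⟩) ∨
    (∃ s u v, Gen p s u v ∧ f = ⟨relP s, stateArgs u v⟩)}

theorem mem_genInst_relP {p : List Instr} {s₀ s : ℕ} {l : List Term} :
    ⟨relP s, l⟩ ∈ genInst p s₀ ↔ ∃ u v, Gen p s u v ∧ l = stateArgs u v := by
  simp [genInst, relP, relS, relE, relF]

theorem mem_genInst_relE {p : List Instr} {s₀ : ℕ} {l : List Term} :
    ⟨relE, l⟩ ∈ genInst p s₀ ↔ ∃ a u, l = [wordTerm (a :: u), letterTerm a, wordTerm u] := by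
  simp [genInst, relP, relS, relE, relF]

theorem mem_genInst_relF {p : List Instr} {s₀ : ℕ} {l : List Term} :
    ⟨relF, l⟩ ∈ genInst p s₀ ↔ ∃ a u, l = [wordTerm (a :: u), letterTerm a, wordTerm u] := by
  simp [genInst, relP, relS, relE, relF]

theorem mem_genInst_relS {p : List Instr} {s₀ : ℕ} {l : List Term} :
    ⟨relS, l⟩ ∈ genInst p s₀ ↔ ∃ u v, Gen p s₀ u v ∧ l = [wordTerm u, wordTerm v] := by
  simp [genInst, relP, relS, relE, relF]

/-- Assign the variables `0`–`4` to the letters. -/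
def letterAssign (x y z : Term) : ℕ → Term
  | 0 => letterTerm 0
  | 1 => letterTerm 1
  | 2 => letterTerm 2
  | 3 => letterTerm 3
  | 4 => letterTerm 4
  | 5 => x
  | 6 => y
  | _ => z

theorem letterAssign_letter (x y z : Term) (a : Fin 5) :
    letterAssign x y z a = letterTerm a := by
  fin_cases a <;> rfl

theorem isModel_genInst (p : List Instr) (s₀ : ℕ) : IsModel (genInst p s₀) (genTGDs p s₀) := by
  intro t ht
  rcases List.mem_cons.1 ht with rfl | ht
  · intro g hg
    obtain ⟨u, v, huv, h⟩ := mem_genInst_relP.1 (hg _ List.mem_cons_self)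
    simp only [stateArgs, List.map_cons, List.map_nil, List.cons.injEq, and_true] at h
    refine ⟨g, ?_, fun _ _ => rfl⟩
    simp only [startTGD, List.mem_cons, List.not_mem_nil, or_false, forall_eq]
    exact mem_genInst_relS.2 ⟨u, v, huv, by simp [h]⟩
  · obtain ⟨i, hi, rfl⟩ := List.mem_map.1 ht
    cases i with
    | halt s =>
      intro g _
      refine ⟨letterAssign (wordTerm []) (wordTerm []) (wordTerm []), ?_, by simp [Instr.tgd]⟩
      simp only [Instr.tgd, List.mem_cons, List.not_mem_nil, or_false, forall_eq]
      exact mem_genInst_relP.2 ⟨_, _, .halt hi, rfl⟩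
    | read s a s' =>
      intro g hg
      obtain ⟨u, v, huv, h⟩ := mem_genInst_relP.1 (hg _ List.mem_cons_self)
      simp only [stateArgs, List.map_cons, List.map_nil, List.cons.injEq, and_true] at h
      refine ⟨letterAssign (wordTerm u) (wordTerm v) (wordTerm (a :: u)), ?_,
        by simp [Instr.tgd, letterAssign, h]⟩
      simp only [Instr.tgd, List.mem_cons, List.not_mem_nil, or_false, forall_eq_or_imp, forall_eq]
      refine ⟨mem_genInst_relE.2 ⟨a, u, ?_⟩, mem_genInst_relP.2 ⟨_, _, .read hi huv, rfl⟩⟩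
      simp [letterAssign_letter]
      simp [letterAssign]
    | write s a s' =>
      intro g hg
      obtain ⟨u, v, huv, h⟩ := mem_genInst_relP.1 (hg _ List.mem_cons_self)
      simp only [stateArgs, List.map_cons, List.map_nil, List.cons.injEq, and_true] at h
      refine ⟨letterAssign (wordTerm u) (wordTerm v) (wordTerm (a :: v)), ?_,
        by simp [Instr.tgd, letterAssign, h]⟩
      simp only [Instr.tgd, List.mem_cons, List.not_mem_nil, or_false, forall_eq_or_imp, forall_eq]
      refine ⟨mem_genInst_relF.2 ⟨a, v, ?_⟩, mem_genInst_relP.2 ⟨_, _, .write hi huv, rfl⟩⟩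
      simp [letterAssign_letter]
      simp [letterAssign]

theorem exists_prefix_of_rungs {p : List Instr} {s₀ : ℕ} (n : ℕ) {h : ℕ → Term}
    {u v : List (Fin 5)} (hu : h 0 = wordTerm u) (hv : h 1 = wordTerm v)
    (hh : ∀ i < n, Rung (genInst p s₀) h i) :
    ∃ w u' v', w.length = n ∧ u = w ++ u' ∧ v = w ++ v' := by
  induction n generalizing h u v with
  | zero => exact ⟨[], u, v, rfl, rfl, rfl⟩
  | succ n ih =>
    obtain ⟨hE, hF⟩ := hh 0 (Nat.succ_pos n)
    obtain ⟨a, u', ha⟩ := mem_genInst_relE.1 hE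
    obtain ⟨b, v', hb⟩ := mem_genInst_relF.1 hF
    simp only [List.cons.injEq, and_true, mul_zero, zero_add] at ha hb
    obtain rfl : u = a :: u' := wordTerm_inj (hu.symm.trans ha.1)
    obtain rfl : v = b :: v' := wordTerm_inj (hv.symm.trans hb.1)
    obtain rfl : a = b := letterTerm_inj (ha.2.1.symm.trans hb.2.1)
    obtain ⟨w, u'', v'', hw, rfl, rfl⟩ := ih (h := fun i => h (i + 3)) ha.2.2 hb.2.2
      fun i hi => hh (i + 1) (by omega)
    exact ⟨a :: w, u'', v'', by simp [hw], rfl, rfl⟩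

/-- A path labelled with the word `w` that starts in `x`. -/
def HasPath (J : Inst) (r : RelSym) (e : ℕ → Term) : List (Fin 5) → Term → Prop
  | [], _ => True
  | a :: w, x => ∃ y, ⟨r, [x, e a, y]⟩ ∈ J ∧ HasPath J r e w y

theorem HasPath.congr {J : Inst} {r : RelSym} {e e' : ℕ → Term} (h : ∀ a : Fin 5, e a = e' a)
    {w : List (Fin 5)} {x : Term} (hw : HasPath J r e w x) : HasPath J r e' w x := by
  induction w generalizing x with
  | nil => trivial
  | cons a w ih =>
    obtain ⟨y, hy, hw⟩ := hw
    exact ⟨y, h a ▸ hy, ih hw⟩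

theorem Gen.exists_hasPath {p : List Instr} {s₀ s : ℕ} {u v : List (Fin 5)} (h : Gen p s u v)
    {J : Inst} (hJ : IsModel J (genTGDs p s₀)) :
    ∃ e : ℕ → Term, (⟨relP s, [e 0, e 1, e 2, e 3, e 4, e 5, e 6]⟩ : Fct) ∈ J ∧
      HasPath J relE e u (e 5) ∧ HasPath J relF e v (e 6) := by
  induction h with
  | halt hi =>
    obtain ⟨g, hg, -⟩ := hJ _ (List.mem_cons_of_mem _ (List.mem_map_of_mem hi))
      (fun _ => Term.null 0) (by simp [Instr.tgd])
    exact ⟨g, hg _ List.mem_cons_self, trivial, trivial⟩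
  | @read s a s' u v hi _ ih =>
    obtain ⟨e, he, hu, hv⟩ := ih
    obtain ⟨g, hg, hfr⟩ := hJ _ (List.mem_cons_of_mem _ (List.mem_map_of_mem hi)) e
      (by simpa [Instr.tgd, Atom.inst] using he)
    simp only [Instr.tgd, List.mem_cons, List.not_mem_nil, or_false, forall_eq_or_imp, forall_eq,
      Atom.inst, List.map_cons, List.map_nil] at hg hfr
    let e' : ℕ → Term := fun i => if i = 5 then g 7 else e i
    have hee : ∀ b : Fin 5, e b = e' b := fun b => by simp [e', b.isLt.ne]
    have hge : ∀ b : Fin 5, g b = e b := fun b => by fin_cases b <;> simp [hfr]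
    refine ⟨e', ?_, ⟨e 5, ?_, hu.congr hee⟩, hv.congr hee⟩
    · simpa [e', hfr] using hg.2
    · rw [← hee, ← hge, ← hfr.2.2.2.2.2.1]
      exact hg.1
  | @write s a s' u v hi _ ih =>
    obtain ⟨e, he, hu, hv⟩ := ih
    obtain ⟨g, hg, hfr⟩ := hJ _ (List.mem_cons_of_mem _ (List.mem_map_of_mem hi)) e
      (by simpa [Instr.tgd, Atom.inst] using he)
    simp only [Instr.tgd, List.mem_cons, List.not_mem_nil, or_false, forall_eq_or_imp, forall_eq,
      Atom.inst, List.map_cons, List.map_nil] at hg hfr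
    let e' : ℕ → Term := fun i => if i = 6 then g 7 else e i
    have hee : ∀ b : Fin 5, e b = e' b := fun b => by
      have : (b : ℕ) ≠ 6 := by omega
      simp [e', this]
    have hge : ∀ b : Fin 5, g b = e b := fun b => by fin_cases b <;> simp [hfr]
    refine ⟨e', ?_, hu.congr hee, ⟨e 6, ?_, hv.congr hee⟩⟩
    · simpa [e', hfr] using hg.2
    · rw [← hee, ← hge, ← hfr.2.2.2.2.2.2]
      exact hg.1

theorem exists_rungs_of_hasPath {J : Inst} {e : ℕ → Term} (w : List (Fin 5)) {u v : List (Fin 5)}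
    {x y : Term} (hx : HasPath J relE e (w ++ u) x) (hy : HasPath J relF e (w ++ v) y) :
    ∃ h : ℕ → Term, h 0 = x ∧ h 1 = y ∧ ∀ i < w.length, Rung J h i := by
  induction w generalizing x y with
  | nil => exact ⟨consRung x y x fun _ => x, rfl, rfl, by simp⟩
  | cons a w ih =>
    obtain ⟨x', hx', hx⟩ := hx
    obtain ⟨y', hy', hy⟩ := hy
    obtain ⟨h, rfl, rfl, hh⟩ := ih hx hy
    exact ⟨consRung x y (e a) h, rfl, rfl, rung_consRung hx' hy' hh⟩

/-- The words read and written by the program starting in `s` can agree on arbitrarily long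
prefixes. -/
def Unbounded (p : List Instr) (s : ℕ) : Prop :=
  ∀ n, ∃ w u v, w.length = n ∧ Gen p s (w ++ u) (w ++ v)

theorem cqConservative_genTGDs_iff {p : List Instr} {s : ℕ} :
    CQConservative (genTGDs p s) ladderTGDs {r | r ∈ ([] : List RelSym)}
      {r | r ∈ querySchema} ↔ Unbounded p s := by
  rw [cqConservative_ladderTGDs_iff]
  refine forall_congr' fun n => ⟨?_, ?_⟩
  · rintro ⟨h, hh⟩
    obtain ⟨g, hg⟩ := (cqHom_ladderCQ.2 hh).of_chase (fun t ht => (genTGDs_wf_linear p s t ht).1)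
      Set.finite_empty (Set.empty_subset _) (isModel_genInst p s)
    obtain ⟨hS, hR⟩ := cqHom_ladderCQ.1 hg
    obtain ⟨u, v, huv, he⟩ := mem_genInst_relS.1 hS
    simp only [List.cons.injEq, and_true] at he
    obtain ⟨w, u', v', hw, rfl, rfl⟩ := exists_prefix_of_rungs n he.1 he.2 hR
    exact ⟨w, u', v', hw, huv⟩
  · rintro ⟨w, u, v, rfl, hw⟩
    have hJ := isModel_chase (genTGDs p s) Set.finite_empty
    obtain ⟨e, he, hx, hy⟩ := hw.exists_hasPath hJ
    obtain ⟨h, h0, h1, hh⟩ := exists_rungs_of_hasPath w hx hy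
    refine ⟨h, ?_, hh⟩
    obtain ⟨g, hg, hfr⟩ := hJ _ List.mem_cons_self e (by simpa [startTGD, Atom.inst] using he)
    simp only [startTGD, List.mem_cons, List.not_mem_nil, or_false, forall_eq_or_imp, forall_eq,
      Atom.inst, List.map_cons, List.map_nil] at hg hfr
    rw [h0, h1, ← hfr.1, ← hfr.2]
    exact hg

end Ladder

/-! ### Queue automata -/

section Queue

variable {Q : Type} (δ : Q → Fin 5 → Option (List (Fin 5) × Q))

/-- A step of a queue automaton: remove the first letter, append a word, change the state. -/
def qstep : Q × List (Fin 5) → Option (Q × List (Fin 5))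
  | (_, []) => none
  | (q, a :: w) => (δ q a).map fun x => (x.2, w ++ x.1)

variable [Encodable Q]

/-- The control state in which `v` has to be written before going to `q`. -/
def ctrl (v : List (Fin 5)) (q : Q) : ℕ := Nat.pair (Encodable.encode v) (Encodable.encode q)

theorem ctrl_inj {v v' : List (Fin 5)} {q q' : Q} (h : ctrl v q = ctrl v' q') :
    v = v' ∧ q = q' := by
  obtain ⟨h₁, h₂⟩ := Nat.pair_eq_pair.1 h
  exact ⟨Encodable.encode_injective h₁, Encodable.encode_injective h₂⟩

def writesOf (q : Q) : List (Fin 5) → List Instr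
  | [] => []
  | a :: v => .write (ctrl (a :: v) q) a (ctrl v q) :: writesOf q v

theorem mem_writesOf {q : Q} {v : List (Fin 5)} {i : Instr} (h : i ∈ writesOf q v) :
    ∃ a v', i = .write (ctrl (a :: v') q) a (ctrl v' q) := by
  induction v with
  | nil => simp [writesOf] at h
  | cons a v ih =>
    rcases List.mem_cons.1 h with h | h
    · exact ⟨a, v, h⟩
    · exact ih h

theorem Gen.write_word {p : List Instr} {q : Q} {u v w : List (Fin 5)} (hv : writesOf q v ⊆ p)
    (h : Gen p (ctrl [] q) u w) : Gen p (ctrl v q) u (v ++ w) := by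
  induction v with
  | nil => exact h
  | cons a v ih =>
    exact .write (hv List.mem_cons_self) (ih fun i hi => hv (List.mem_cons_of_mem _ hi))

def transProg (q : Q) (a : Fin 5) : Option (List (Fin 5) × Q) → List Instr
  | none => []
  | some (v, q') => .read (ctrl [] q) a (ctrl v q') :: writesOf q' v

theorem mem_transProg {q : Q} {a : Fin 5} {o : Option (List (Fin 5) × Q)} {i : Instr}
    (h : i ∈ transProg q a o) :
    (∃ v q', o = some (v, q') ∧ i = .read (ctrl [] q) a (ctrl v q')) ∨
      ∃ (b : Fin 5) (v : List (Fin 5)) (q' : Q), i = .write (ctrl (b :: v) q') b (ctrl v q') := by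
  rcases o with _ | ⟨v, q'⟩
  · simp [transProg] at h
  · rcases List.mem_cons.1 h with h | h
    · exact Or.inl ⟨v, q', rfl, h⟩
    · obtain ⟨b, v', h⟩ := mem_writesOf h
      exact Or.inr ⟨b, v', q', h⟩

variable [Fintype Q]

noncomputable def coreProg : List Instr :=
  (Finset.univ : Finset Q).toList.flatMap fun q =>
    .halt (ctrl [] q) :: (List.finRange 5).flatMap fun a => transProg q a (δ q a)

/-- The program that reads the word consumed by the automaton and writes the initial queue
followed by everything that is appended. -/
noncomputable def queueProg (q₀ : Q) (w₀ : List (Fin 5)) : List Instr :=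
  coreProg δ ++ writesOf q₀ w₀

variable {δ} {q₀ : Q} {w₀ : List (Fin 5)}

theorem mem_queueProg {i : Instr} : i ∈ queueProg δ q₀ w₀ ↔
    (∃ q : Q, i = .halt (ctrl [] q)) ∨ (∃ (q : Q) (a : Fin 5), i ∈ transProg q a (δ q a)) ∨
      i ∈ writesOf q₀ w₀ := by
  simp [queueProg, coreProg, exists_or, or_assoc]

theorem halt_mem_queueProg (q : Q) : .halt (ctrl [] q) ∈ queueProg δ q₀ w₀ :=
  mem_queueProg.2 (Or.inl ⟨q, rfl⟩)

theorem transProg_subset {q q' : Q} {a : Fin 5} {v : List (Fin 5)} (h : δ q a = some (v, q')) :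
    .read (ctrl [] q) a (ctrl v q') :: writesOf q' v ⊆ queueProg δ q₀ w₀ := fun i hi =>
  mem_queueProg.2 (Or.inr (Or.inl ⟨q, a, by rwa [h]⟩))

theorem mem_queueProg_cases {i : Instr} (h : i ∈ queueProg δ q₀ w₀) :
    (∃ q : Q, i = .halt (ctrl [] q)) ∨
      (∃ q a v q', δ q a = some (v, q') ∧ i = .read (ctrl [] q) a (ctrl v q')) ∨
      ∃ (b : Fin 5) (v : List (Fin 5)) (q : Q), i = .write (ctrl (b :: v) q) b (ctrl v q) := by
  rcases mem_queueProg.1 h with h | ⟨q, a, h⟩ | h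
  · exact Or.inl h
  · rcases mem_transProg h with ⟨v, q', h⟩ | h
    · exact Or.inr (Or.inl ⟨q, a, v, q', h⟩)
    · exact Or.inr (Or.inr h)
  · obtain ⟨b, v, h⟩ := mem_writesOf h
    exact Or.inr (Or.inr ⟨b, v, q₀, h⟩)

theorem Gen.exists_of_ctrl {q : Q} {v u y : List (Fin 5)}
    (h : Gen (queueProg δ q₀ w₀) (ctrl v q) u y) :
    ∃ y', y = v ++ y' ∧ Gen (queueProg δ q₀ w₀) (ctrl [] q) u y' := by
  induction v generalizing y with
  | nil => exact ⟨y, rfl, h⟩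
  | cons b v ih =>
    generalize hs : ctrl (b :: v) q = s at h
    cases h with
    | halt hi =>
      rcases mem_queueProg_cases hi with ⟨q', h⟩ | ⟨_, _, _, _, _, h⟩ | ⟨_, _, _, h⟩
      · simp only [Instr.halt.injEq] at h
        exact absurd (ctrl_inj (hs.trans h)).1 (by simp)
      · simp at h
      · simp at h
    | read hi _ =>
      rcases mem_queueProg_cases hi with ⟨q', h⟩ | ⟨_, _, _, _, _, h⟩ | ⟨_, _, _, h⟩
      · simp at h
      · simp only [Instr.read.injEq] at h
        exact absurd (ctrl_inj (hs.trans h.1)).1 (by simp)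
      · simp at h
    | write hi hg =>
      rcases mem_queueProg_cases hi with ⟨q', h⟩ | ⟨_, _, _, _, _, h⟩ | ⟨c, v', q', h⟩
      · simp at h
      · simp at h
      · simp only [Instr.write.injEq] at h
        obtain ⟨h₁, rfl, rfl⟩ := h
        obtain ⟨h₂, rfl⟩ := ctrl_inj (hs.trans h₁)
        obtain ⟨rfl, rfl⟩ := List.cons.inj h₂
        obtain ⟨y', rfl, hy'⟩ := ih hg
        exact ⟨y', rfl, hy'⟩

theorem Gen.exists_of_cons {q : Q} {a : Fin 5} {u y : List (Fin 5)}
    (h : Gen (queueProg δ q₀ w₀) (ctrl [] q) (a :: u) y) :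
    ∃ v q' y', δ q a = some (v, q') ∧ y = v ++ y' ∧
      Gen (queueProg δ q₀ w₀) (ctrl [] q') u y' := by
  generalize hs : ctrl [] q = s at h
  cases h with
  | read hi hg =>
    rcases mem_queueProg_cases hi with ⟨q', h⟩ | ⟨q₁, b, v, q', hδ, h⟩ | ⟨_, _, _, h⟩
    · simp at h
    · simp only [Instr.read.injEq] at h
      obtain ⟨h₁, rfl, rfl⟩ := h
      obtain ⟨-, rfl⟩ := ctrl_inj (hs.trans h₁)
      obtain ⟨y', rfl, hy'⟩ := hg.exists_of_ctrl
      exact ⟨v, q', y', hδ, rfl, hy'⟩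
    · simp at h
  | write hi hg =>
    rcases mem_queueProg_cases hi with ⟨q', h⟩ | ⟨_, _, _, _, _, h⟩ | ⟨c, v', q', h⟩
    · simp at h
    · simp at h
    · simp only [Instr.write.injEq] at h
      exact absurd (ctrl_inj (hs.trans h.1)).1 (by simp)

theorem eval_dom_of_eq_none {α : Type} {f : α → Option α} {a : α} (h : f a = none) :
    (StateTransition.eval f a).Dom :=
  Part.dom_iff_mem.2 ⟨a, StateTransition.mem_eval.2 ⟨Relation.ReflTransGen.refl, h⟩⟩

theorem exists_gen_of_not_dom (n : ℕ) {q : Q} {w : List (Fin 5)}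
    (h : ¬ (StateTransition.eval (qstep δ) (q, w)).Dom) :
    ∃ p v w', p.length = n ∧ Gen (queueProg δ q₀ w₀) (ctrl [] q) p v ∧ w ++ v = p ++ w' := by
  induction n generalizing q w with
  | zero => exact ⟨[], [], w, rfl, .halt (halt_mem_queueProg q), by simp⟩
  | succ n ih =>
    cases hq : qstep δ (q, w) with
    | none => exact absurd (eval_dom_of_eq_none hq) h
    | some c =>
      have hc : ¬ (StateTransition.eval (qstep δ) c).Dom := by
        rwa [← StateTransition.reaches_eval (.single (Option.mem_def.2 hq))]
      cases w with
      | nil => simp [qstep] at hq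
      | cons a w =>
        obtain ⟨⟨v₁, q'⟩, hδ, rfl⟩ := Option.map_eq_some_iff.1 hq
        obtain ⟨p, v, w', hp, hg, hw⟩ := ih hc
        have hsub := transProg_subset (q₀ := q₀) (w₀ := w₀) hδ
        refine ⟨a :: p, v₁ ++ v, w', by simp [hp], .read (hsub List.mem_cons_self)
          (hg.write_word fun i hi => hsub (List.mem_cons_of_mem _ hi)), ?_⟩
        simpa using hw

theorem unbounded_of_not_dom (h : ¬ (StateTransition.eval (qstep δ) (q₀, w₀)).Dom) :
    Unbounded (queueProg δ q₀ w₀) (ctrl w₀ q₀) := by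
  intro n
  obtain ⟨p, v, w', hp, hg, hw⟩ := exists_gen_of_not_dom (q₀ := q₀) (w₀ := w₀) n h
  refine ⟨p, [], w', hp, ?_⟩
  rw [List.append_nil, ← hw]
  exact hg.write_word fun i hi => mem_queueProg.2 (Or.inr (Or.inr hi))

theorem exists_bound_of_reaches {c d : Q × List (Fin 5)} (hd : ∀ a, δ d.1 a = none)
    (h : StateTransition.Reaches (qstep δ) c d) :
    ∃ N, ∀ p u v w', c.2 ++ v = p ++ w' →
      Gen (queueProg δ q₀ w₀) (ctrl [] c.1) (p ++ u) v → p.length ≤ N := by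
  induction h using Relation.ReflTransGen.head_induction_on with
  | refl =>
    refine ⟨0, fun p u v w' _ hg => ?_⟩
    cases p with
    | nil => rfl
    | cons a p =>
      obtain ⟨_, _, _, h, -⟩ := hg.exists_of_cons
      simp [hd a] at h
  | @head x _ hab _ ih =>
    obtain ⟨N, hN⟩ := ih
    refine ⟨N + 1, fun p u v w' hw hg => ?_⟩
    obtain ⟨q, w⟩ := x
    cases w with
    | nil => simp [qstep] at hab
    | cons a w =>
      obtain ⟨⟨v₁, q'⟩, hδ, rfl⟩ := Option.map_eq_some_iff.1 hab
      cases p with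
      | nil => simp
      | cons b p =>
        obtain ⟨rfl, hw⟩ := List.cons.inj hw
        obtain ⟨v₂, q₂, y, hδ', rfl, hg⟩ := hg.exists_of_cons
        obtain ⟨rfl, rfl⟩ := Prod.mk.inj (Option.some.inj (hδ.symm.trans hδ'))
        exact Nat.succ_le_succ (hN p u y w' (by simpa using hw) hg)

theorem not_unbounded_of_reaches {d : Q × List (Fin 5)} (hd : ∀ a, δ d.1 a = none)
    (h : StateTransition.Reaches (qstep δ) (q₀, w₀) d) :
    ¬ Unbounded (queueProg δ q₀ w₀) (ctrl w₀ q₀) := by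
  intro H
  obtain ⟨N, hN⟩ := exists_bound_of_reaches (q₀ := q₀) (w₀ := w₀) hd h
  obtain ⟨w, u, v, hw, hg⟩ := H (N + 1)
  obtain ⟨y, hy, hg⟩ := hg.exists_of_ctrl
  have := hN w u y v hy.symm hg
  omega

end Queue

/-! ### Stack machines and their simulation by queue automata -/

section Stacks

open Turing.PartrecToTM2 StateTransition

variable {C : Type}

/-- The function `f` receives the top of stack `k`, which is popped, and returns the word to be
pushed and the new control state. -/
abbrev StackOp (C : Type) : Type := K' × (Option Γ' → List Γ' × C)

def stackUpd (S : K' → List Γ') (k : K') (v : List Γ') : K' → List Γ' :=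
  Function.update S k (v ++ (S k).tail)

/-- A step of the machine with four stacks given by `op`; it halts where `op` is undefined. -/
def stackStep (op : C → Option (StackOp C)) (x : C × (K' → List Γ')) :
    Option (C × (K' → List Γ')) :=
  (op x.1).map fun o =>
    ((o.2 (x.2 o.1).head?).2, stackUpd x.2 o.1 (o.2 (x.2 o.1).head?).1)

def letter : Γ' → Fin 5
  | .consₗ => 0
  | .cons => 1
  | .bit0 => 2
  | .bit1 => 3

/-- The partial inverse of `letter`; the letter `4` is the separator. -/
def unletter (a : Fin 5) : Option Γ' :=
  if a = 0 then some .consₗ else if a = 1 then some .cons else if a = 2 then some .bit0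
  else if a = 3 then some .bit1 else none

theorem unletter_letter (g : Γ') : unletter (letter g) = some g := by
  cases g <;> rfl

theorem unletter_separator : unletter 4 = none := rfl

def nextStack : K' → K'
  | .main => .rev
  | .rev => .aux
  | .aux => .stack
  | .stack => .main

def otherStacks : K' → List K'
  | .main => [.rev, .aux, .stack]
  | .rev => [.aux, .stack, .main]
  | .aux => [.stack, .main, .rev]
  | .stack => [.main, .rev, .aux]

theorem nextStack_cons_otherStacks (j : K') :
    nextStack j :: otherStacks (nextStack j) = otherStacks j ++ [j] := by
  cases j <;> rfl

theorem notMem_otherStacks (j : K') : j ∉ otherStacks j := by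
  cases j <;> simp [otherStacks]

theorem exists_iterate_nextStack (j k : K') : ∃ n, nextStack^[n] j = k := by
  cases j <;> cases k <;>
    first | exact ⟨0, rfl⟩ | exact ⟨1, rfl⟩ | exact ⟨2, rfl⟩ | exact ⟨3, rfl⟩

def stackWord (S : K' → List Γ') (l : List K') : List (Fin 5) :=
  l.flatMap fun k => (S k).map letter ++ [4]

/-- The queue content when stack `j` is in front. -/
def stacksWord (S : K' → List Γ') (j : K') : List (Fin 5) := stackWord S (j :: otherStacks j)

theorem stacksWord_eq (S : K' → List Γ') (j : K') :
    stacksWord S j = (S j).map letter ++ 4 :: stackWord S (otherStacks j) := by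
  simp [stacksWord, stackWord]

theorem stacksWord_nextStack (S : K' → List Γ') (j : K') :
    stacksWord S (nextStack j) = stackWord S (otherStacks j) ++ ((S j).map letter ++ [4]) := by
  rw [stacksWord, nextStack_cons_otherStacks]
  simp [stackWord]

theorem stackWord_stackUpd (S : K' → List Γ') (k : K') (v : List Γ') :
    stackWord (stackUpd S k v) (otherStacks k) = stackWord S (otherStacks k) := by
  refine List.flatMap_congr fun j hj => ?_
  have : j ≠ k := by
    rintro rfl
    exact notMem_otherStacks j hj
  simp [stackUpd, this]

/-- Copy a stack in state `q`, then go to `q'`. -/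
def copyTrans {Q : Type} (q q' : Q) (a : Fin 5) : List (Fin 5) × Q :=
  if (unletter a).isSome then ([a], q) else ([a], q')

theorem reaches_copy {Q : Type} {δ : Q → Fin 5 → Option (List (Fin 5) × Q)} {q q' : Q}
    (h : ∀ a, δ q a = some (copyTrans q q' a)) (l : List Γ') (w : List (Fin 5)) :
    Reaches (qstep δ) (q, l.map letter ++ 4 :: w) (q', w ++ (l.map letter ++ [4])) := by
  induction l generalizing w with
  | nil =>
    refine .single (Option.mem_def.2 ?_)
    simp [qstep, h, copyTrans, unletter_separator]
  | cons g l ih =>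
    refine .head (b := (q, l.map letter ++ 4 :: (w ++ [letter g]))) (Option.mem_def.2 ?_) ?_
    · simp [qstep, h, copyTrans, unletter_letter]
    · simpa [Reaches] using ih (w ++ [letter g])

/-- The automaton keeps the four stacks, separated by `4`, in its queue. In a state
`((c, j), false)` stack `j` is in front and the operation of `c` has not been performed yet; in a
state `((c, j), true)` it has, and the rest of stack `j` still has to be copied. -/
def stackTrans (op : C → Option (StackOp C)) :
    (C × K') × Bool → Fin 5 → Option (List (Fin 5) × ((C × K') × Bool))
  | ((c, j), true), a => some (copyTrans ((c, j), true) ((c, nextStack j), false) a)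
  | ((c, j), false), a => (op c).map fun o =>
      if j = o.1 then
        match unletter a with
        | some g => ((o.2 (some g)).1.map letter, (((o.2 (some g)).2, j), true))
        | none => ((o.2 none).1.map letter ++ [4], (((o.2 none).2, nextStack j), false))
      else copyTrans ((c, j), false) ((c, nextStack j), false) a

variable {op : C → Option (StackOp C)}

theorem stackTrans_of_eq_none {c : C} (hc : op c = none) (j : K') (a : Fin 5) :
    stackTrans op ((c, j), false) a = none := by
  simp [stackTrans, hc]

theorem reaches_stack {c : C} {o : StackOp C} (hc : op c = some o) (S : K' → List Γ') (j : K') :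
    Reaches (qstep (stackTrans op)) (((c, j), false), stacksWord S j)
      (((c, o.1), false), stacksWord S o.1) := by
  obtain ⟨n, hn⟩ := exists_iterate_nextStack j o.1
  induction n generalizing j with
  | zero =>
    obtain rfl : j = o.1 := hn
    exact .refl
  | succ n ih =>
    by_cases hj : j = o.1
    · rw [hj]
      exact .refl
    · refine Relation.ReflTransGen.trans ?_ (ih (nextStack j) hn)
      rw [stacksWord_eq, stacksWord_nextStack]
      exact reaches_copy (fun a => by simp [stackTrans, hc, hj]) _ _

theorem reaches₁_stack {c : C} {o : StackOp C} (hc : op c = some o) (S : K' → List Γ') :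
    Reaches₁ (qstep (stackTrans op)) (((c, o.1), false), stacksWord S o.1)
      ((((o.2 (S o.1).head?).2, nextStack o.1), false),
        stacksWord (stackUpd S o.1 (o.2 (S o.1).head?).1) (nextStack o.1)) := by
  rw [stacksWord_eq, stacksWord_nextStack, stackWord_stackUpd]
  cases hS : S o.1 with
  | nil =>
    refine .single (Option.mem_def.2 ?_)
    simp [qstep, stackTrans, hc, unletter_separator, stackUpd, hS]
  | cons g l =>
    let v := (o.2 (some g)).1.map letter
    have := reaches_copy (δ := stackTrans op) (q := (((o.2 (some g)).2, o.1), true))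
      (fun a => rfl) l (stackWord S (otherStacks o.1) ++ v)
    refine Relation.TransGen.head' (b := ((((o.2 (some g)).2, o.1), true),
      l.map letter ++ 4 :: (stackWord S (otherStacks o.1) ++ v))) (Option.mem_def.2 ?_) ?_
    · simp [qstep, stackTrans, hc, unletter_letter, v]
    · simpa [Reaches, stackUpd, hS, v] using this

def StackRel (x : C × (K' → List Γ')) (y : ((C × K') × Bool) × List (Fin 5)) : Prop :=
  ∃ j, y = (((x.1, j), false), stacksWord x.2 j)

theorem respects_stackTrans (op : C → Option (StackOp C)) :
    Respects (stackStep op) (qstep (stackTrans op)) StackRel := by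
  rintro ⟨c, S⟩ _ ⟨j, rfl⟩
  cases hc : op c with
  | none =>
    simp only [stackStep, hc, Option.map_none]
    cases stacksWord S j with
    | nil => rfl
    | cons a w => simp [qstep, stackTrans_of_eq_none hc]
  | some o =>
    simp only [stackStep, hc, Option.map_some]
    exact ⟨_, ⟨_, rfl⟩, Relation.TransGen.trans_right (reaches_stack hc S j) (reaches₁_stack hc S)⟩

/-- The program for the stack machine is unbounded if and only if the machine does not halt. -/
theorem unbounded_stack_iff [Encodable ((C × K') × Bool)]
    [Fintype ((C × K') × Bool)] (c : C) (S : K' → List Γ') :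
    Unbounded (queueProg (stackTrans op) ((c, K'.main), false) (stacksWord S .main))
      (ctrl (stacksWord S .main) ((c, K'.main), false)) ↔ ¬ (eval (stackStep op) (c, S)).Dom := by
  have hrel : StackRel (c, S) (((c, K'.main), false), stacksWord S .main) := ⟨_, rfl⟩
  refine ⟨fun H hdom => ?_, fun H => unbounded_of_not_dom fun hdom =>
    H ((tr_eval_dom (respects_stackTrans op) hrel).1 hdom)⟩
  obtain ⟨⟨c', S'⟩, hx⟩ := Part.dom_iff_mem.1 hdom
  obtain ⟨_, ⟨j, rfl⟩, hy⟩ := tr_eval (respects_stackTrans op) hrel hx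
  have hc : op c' = none := by simpa [stackStep] using (mem_eval.1 hx).2
  exact not_unbounded_of_reaches (stackTrans_of_eq_none hc j) (mem_eval.1 hy).1 H

end Stacks

/-! ### Stack machines for partial recursive functions -/

section MicroSteps

open Turing Turing.PartrecToTM2 StateTransition

theorem stackUpd_head? (S : K' → List Γ') (k : K') : stackUpd S k (S k).head?.toList = S := by
  cases h : S k with
  | nil => simp [stackUpd, h, Function.update_eq_self_iff]
  | cons a l => simp [stackUpd, h, Function.update_eq_self_iff]

variable {Λ σ : Type}

/-- The operation performed by the outermost constructor of a statement. -/
def microOp (M : Λ → TM2.Stmt (fun _ : K' => Γ') Λ σ) :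
    TM2.Stmt (fun _ : K' => Γ') Λ σ × σ → Option (StackOp (TM2.Stmt (fun _ : K' => Γ') Λ σ × σ))
  | (.push k f q, v) => some (k, fun x => (f v :: x.toList, q, v))
  | (.peek k f q, v) => some (k, fun x => (x.toList, q, f v x))
  | (.pop k f q, v) => some (k, fun x => ([], q, f v x))
  | (.load f q, v) => some (.main, fun x => (x.toList, q, f v))
  | (.branch f q₁ q₂, v) => some (.main, fun x => (x.toList, cond (f v) q₁ q₂, v))
  | (.goto l, v) => some (.main, fun x => (x.toList, M (l v), v))
  | (.halt, _) => none

inductive MicroRel : TM2.Cfg (fun _ : K' => Γ') Λ σ →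
    (TM2.Stmt (fun _ : K' => Γ') Λ σ × σ) × (K' → List Γ') → Prop
  | goto (f : σ → Λ) (v : σ) (S : K' → List Γ') : MicroRel ⟨some (f v), v, S⟩ ((.goto f, v), S)
  | halt (v : σ) (S : K' → List Γ') : MicroRel ⟨none, v, S⟩ ((.halt, v), S)

variable {M : Λ → TM2.Stmt (fun _ : K' => Γ') Λ σ}

theorem exists_reaches_stepAux (q : TM2.Stmt (fun _ : K' => Γ') Λ σ) (v : σ) (S : K' → List Γ') :
    ∃ b, MicroRel (TM2.stepAux q v S) b ∧ Reaches (stackStep (microOp M)) ((q, v), S) b := by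
  induction q generalizing v S with
  | push k f q ih =>
    obtain ⟨b, hb, h⟩ := ih v (Function.update S k (f v :: S k))
    refine ⟨b, hb, .head (Option.mem_def.2 ?_) h⟩
    cases hS : S k <;> simp [stackStep, microOp, stackUpd, hS]
  | peek k f q ih =>
    obtain ⟨b, hb, h⟩ := ih (f v (S k).head?) S
    exact ⟨b, hb, .head (Option.mem_def.2 (by simp [stackStep, microOp, stackUpd_head?])) h⟩
  | pop k f q ih =>
    obtain ⟨b, hb, h⟩ := ih (f v (S k).head?) (Function.update S k (S k).tail)
    exact ⟨b, hb, .head (Option.mem_def.2 (by simp [stackStep, microOp, stackUpd])) h⟩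
  | load f q ih =>
    obtain ⟨b, hb, h⟩ := ih (f v) S
    exact ⟨b, hb, .head (Option.mem_def.2 (by simp [stackStep, microOp, stackUpd_head?])) h⟩
  | branch f q₁ q₂ ih₁ ih₂ =>
    have key : ∃ b, MicroRel (TM2.stepAux (.branch f q₁ q₂) v S) b ∧
        Reaches (stackStep (microOp M)) ((cond (f v) q₁ q₂, v), S) b := by
      cases hf : f v
      · simpa [TM2.stepAux, hf] using ih₂ v S
      · simpa [TM2.stepAux, hf] using ih₁ v S
    obtain ⟨b, hb, h⟩ := key
    exact ⟨b, hb, .head (Option.mem_def.2 (by simp [stackStep, microOp, stackUpd_head?])) h⟩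
  | goto f => exact ⟨_, .goto f v S, .refl⟩
  | halt => exact ⟨_, .halt v S, .refl⟩

theorem respects_microOp : Respects (TM2.step M) (stackStep (microOp M)) MicroRel := by
  rintro _ _ (⟨f, v, S⟩ | ⟨v, S⟩)
  · obtain ⟨b, hb, h⟩ := exists_reaches_stepAux (M := M) (M (f v)) v S
    exact ⟨b, hb, .head' (Option.mem_def.2 (by simp [stackStep, microOp, stackUpd_head?])) h⟩
  · rfl

/-- Restrict a stack machine to a set of control states, along a retraction. -/
def restrictOp {C : Type} {F : Set C} (op : C → Option (StackOp C)) (r : C → F) (c : F) :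
    Option (StackOp F) :=
  (op c).map fun o => (o.1, fun x => ((o.2 x).1, r (o.2 x).2))

theorem respects_restrictOp {C : Type} {F : Set C} {op : C → Option (StackOp C)} {r : C → F}
    (hr : ∀ c : F, r c = c) (hF : ∀ c ∈ F, ∀ o, op c = some o → ∀ x, (o.2 x).2 ∈ F) :
    Respects (stackStep op) (stackStep (restrictOp op r)) fun x y => x = (↑y.1, y.2) := by
  rintro _ ⟨c, S⟩ rfl
  cases hc : op c with
  | none => simp [stackStep, restrictOp, hc]
  | some o =>
    simp only [stackStep, hc, Option.map_some]
    refine ⟨_, ?_, .single (Option.mem_def.2 (by simp [stackStep, restrictOp, hc]; rfl))⟩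
    simp [hr ⟨_, hF c c.2 o hc (S o.1).head?⟩]

theorem microOp_closed {S : Finset Λ} (hS : ∀ l ∈ S, TM2.SupportsStmt S (M l)) {l₀ : Λ}
    (hl₀ : l₀ ∈ S) (c : TM2.Stmt (fun _ : K' => Γ') Λ σ × σ)
    (hc : c.1 = .goto (fun _ => l₀) ∨ ∃ l ∈ S, c.1 ∈ TM2.stmts₁ (M l)) (o) (ho : microOp M c = some o)
    (x : Option Γ') :
    (o.2 x).2.1 = .goto (fun _ => l₀) ∨ ∃ l ∈ S, (o.2 x).2.1 ∈ TM2.stmts₁ (M l) := by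
  obtain ⟨q, v⟩ := c
  right
  rcases hc with rfl | ⟨l, hl, hq⟩
  · obtain rfl := Option.some.inj ho
    exact ⟨l₀, hl₀, TM2.stmts₁_self⟩
  · have hq' := TM2.stmts₁_trans hq
    cases q with
    | goto f =>
      obtain rfl := Option.some.inj ho
      exact ⟨f v, TM2.stmts₁_supportsStmt_mono hq (hS l hl) v, TM2.stmts₁_self⟩
    | halt => simp [microOp] at ho
    | branch f q₁ q₂ =>
      obtain rfl := Option.some.inj ho
      refine ⟨l, hl, hq' ?_⟩
      cases h : f v <;> simp [TM2.stmts₁, TM2.stmts₁_self]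
    | _ =>
      obtain rfl := Option.some.inj ho
      exact ⟨l, hl, hq' (by simp [TM2.stmts₁, TM2.stmts₁_self])⟩

theorem exists_stack_machine (c : ToPartrec.Code) :
    ∃ (C : Type) (_ : Finite C) (op : C → Option (StackOp C)) (c₀ : C), ∀ v,
      (eval (stackStep op) (c₀, K'.elim (trList v) [] [] [])).Dom ↔ (c.eval v).Dom := by
  have hsupp := tr_supports c .halt
  let S := codeSupp c .halt
  let l₀ := trNormal c .halt
  have hl₀ : l₀ ∈ S := hsupp.1
  let F : Set (Stmt' × Option Γ') :=
    {x | x.1 = .goto (fun _ => l₀) ∨ ∃ l ∈ S, x.1 ∈ TM2.stmts₁ (tr l)}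
  have hfin : F.Finite := by
    have hA : ({q | q = .goto (fun _ => l₀) ∨ ∃ l ∈ S, q ∈ TM2.stmts₁ (tr l)} :
        Set Stmt').Finite := by
      refine (Set.finite_singleton _).union ((S.finite_toSet.biUnion fun l _ =>
        (TM2.stmts₁ (tr l)).finite_toSet).subset ?_)
      rintro q ⟨l, hl, hq⟩
      exact Set.mem_biUnion hl hq
    exact (hA.prod Set.finite_univ).subset fun x hx => ⟨hx, trivial⟩
  let c₀ : F := ⟨(.goto (fun _ => l₀), none), Or.inl rfl⟩
  classical
  let r : Stmt' × Option Γ' → F := fun x => if h : x ∈ F then ⟨x, h⟩ else c₀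
  have hr : ∀ x : F, r x = x := fun x => dif_pos x.2
  refine ⟨F, hfin.to_subtype, restrictOp (microOp tr) r, c₀, fun v => ?_⟩
  refine (tr_eval_dom (a₁ := ((.goto (fun _ => l₀), none), K'.elim (trList v) [] [] []))
    (respects_restrictOp hr fun c hc o ho x => microOp_closed hsupp.2 hl₀ c hc o ho x) rfl).trans
    ((tr_eval_dom (respects_microOp (M := tr)) (.goto (fun _ => l₀) none _)).trans ?_)
  change (eval (TM2.step tr) (init c v)).Dom ↔ _
  rw [PartrecToTM2.tr_eval]
  rfl

end MicroSteps

/-! ### Computability of the reduction -/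

section Reduction

open Turing Turing.PartrecToTM2 StateTransition

/-- The binary representation of a number, least significant bit first, in the letters used by
the queue automaton. -/
def natBits (n : ℕ) : List (Fin 5) :=
  if n = 0 then [] else (if n % 2 = 0 then 2 else 3) :: natBits (n / 2)
decreasing_by omega

theorem map_letter_trPosNum (p : PosNum) : (trPosNum p).map letter = natBits p := by
  induction p with
  | one => simp [trPosNum, letter, natBits]
  | bit0 p ih =>
    have hp := PosNum.to_nat_pos p
    rw [natBits, PosNum.cast_bit0, if_neg (by omega), if_pos (by omega),
      show ((p : ℕ) + p) / 2 = p by omega, ← ih]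
    rfl
  | bit1 p ih =>
    have hp := PosNum.to_nat_pos p
    rw [natBits, PosNum.cast_bit1, if_neg (by omega), if_neg (by omega),
      show ((p : ℕ) + p + 1) / 2 = p by omega, ← ih]
    rfl

theorem map_letter_trNat (n : ℕ) : (trNat n).map letter = natBits n := by
  have h : ((n : Num) : ℕ) = n := Num.to_of_nat n
  rw [trNat]
  cases hn : (n : Num) with
  | zero =>
    rw [hn] at h
    obtain rfl : 0 = n := h
    simp [trNum, natBits]
  | pos p =>
    rw [hn] at h
    obtain rfl : (p : ℕ) = n := h
    exact map_letter_trPosNum p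

/-- The initial queue for the input `n`. -/
def natWord (n : ℕ) : List (Fin 5) := natBits n ++ [1, 4, 4, 4, 4]

theorem stacksWord_init (n : ℕ) : stacksWord (K'.elim (trList [n]) [] [] []) .main = natWord n := by
  simp [stacksWord, stackWord, otherStacks, trList, map_letter_trNat, natWord, letter]

theorem exists_queue_automaton {f : ℕ →. ℕ} (hf : Partrec f) :
    ∃ (Q : Type) (_ : Encodable Q) (_ : Fintype Q) (δ : Q → Fin 5 → Option (List (Fin 5) × Q))
      (q₀ : Q), ∀ n, Unbounded (queueProg δ q₀ (natWord n)) (ctrl (natWord n) q₀) ↔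
        ¬ (f n).Dom := by
  obtain ⟨c, hc⟩ := ToPartrec.Code.exists_code (Nat.Partrec'.part_iff₁.2 hf)
  obtain ⟨C, _, op, c₀, h⟩ := exists_stack_machine c
  have : Finite K' := Finite.of_surjective (fun i : Fin 4 =>
    (![.main, .rev, .aux, .stack] : Fin 4 → K') i) fun k => by
      cases k
      exacts [⟨0, rfl⟩, ⟨1, rfl⟩, ⟨2, rfl⟩, ⟨3, rfl⟩]
  let : Encodable ((C × K') × Bool) := Encodable.ofCountable _
  let : Fintype ((C × K') × Bool) := Fintype.ofFinite _
  refine ⟨(C × K') × Bool, inferInstance, inferInstance, stackTrans op, ((c₀, .main), false),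
    fun n => ?_⟩
  rw [← stacksWord_init, unbounded_stack_iff, h, hc ⟨[n], rfl⟩]
  rfl

theorem primrec_natBits : Primrec natBits := by
  let g : List (List (Fin 5)) → Option (List (Fin 5)) := fun l =>
    if l.length = 0 then some []
    else (l[l.length / 2]?).map fun w => (if l.length % 2 = 0 then 2 else 3) :: w
  have hlen : Primrec fun l : List (List (Fin 5)) => l.length := Primrec.list_length
  have hg : Primrec g := by
    refine Primrec.ite (Primrec.eq.comp hlen (.const 0)) (.const _) (Primrec.option_map
      (Primrec.list_getElem?.comp .id (Primrec.nat_div.comp hlen (.const 2))) ?_)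
    exact Primrec.list_cons.comp (Primrec.ite
      (Primrec.eq.comp (Primrec.nat_mod.comp (hlen.comp .fst) (.const 2)) (.const 0))
      (.const _) (.const _)) .snd
  have := Primrec.nat_strong_rec (fun (_ : Unit) n => natBits n) (g := fun _ l => g l)
    (hg.comp .snd) fun _ n => by
      rw [natBits]
      by_cases hn : n = 0
      · simp [g, hn]
      · have : n / 2 < n := by omega
        simp [g, hn, this]
  exact this.comp (.const ()) .id

theorem primrec_natWord : Primrec natWord :=
  Primrec.list_append.comp primrec_natBits (.const _)

variable {α : Type} [Primcodable α]

theorem primrec_atom {r : α → RelSym} {l : α → List ℕ} (hr : Primrec r) (hl : Primrec l) :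
    Primrec fun x => (⟨r x, l x⟩ : Atom) :=
  (Primrec.of_equiv_symm (e := atomEquiv)).comp (hr.pair hl)

theorem primrec_tgd {b h : α → List Atom} {f : α → List ℕ} (hb : Primrec b) (hh : Primrec h)
    (hf : Primrec f) : Primrec fun x => (⟨b x, h x, f x⟩ : TGD) :=
  (Primrec.of_equiv_symm (e := tgdEquiv)).comp (hb.pair (hh.pair hf))

theorem primrec_relP : Primrec relP :=
  (Primrec.of_equiv_symm (e := relSymEquiv)).comp
    ((Primrec.nat_add.comp .id (.const 4)).pair (.const 7))

theorem primrec_startTGD : Primrec startTGD :=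
  primrec_tgd (Primrec.list_cons.comp (primrec_atom primrec_relP (.const _)) (.const []))
    (.const _) (.const _)

theorem primrec_write_tgd {s s' : α → ℕ} {a : α → Fin 5} (hs : Primrec s) (ha : Primrec a)
    (hs' : Primrec s') : Primrec fun x => (Instr.write (s x) (a x) (s' x)).tgd :=
  primrec_tgd
    (Primrec.list_cons.comp (primrec_atom (primrec_relP.comp hs') (.const _)) (.const []))
    (Primrec.list_cons.comp
      (primrec_atom (.const relF) (Primrec.list_cons.comp (.const 7)
        (Primrec.list_cons.comp (Primrec.fin_val.comp ha) (.const [6]))))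
      (Primrec.list_cons.comp (primrec_atom (primrec_relP.comp hs) (.const _)) (.const [])))
    (.const _)

variable {Q : Type} [Encodable Q]

theorem primrec_ctrl (q : Q) : Primrec fun v => ctrl v q :=
  Primrec₂.natPair.comp Primrec.encode (.const _)

theorem primrec_writesOf (q : Q) : Primrec fun v => (writesOf q v).map Instr.tgd := by
  refine (Primrec.list_rec (f := fun v : List (Fin 5) => v) (g := fun _ => ([] : List TGD))
    (h := fun _ x => (Instr.write (ctrl (x.1 :: x.2.1) q) x.1 (ctrl x.2.1 q)).tgd :: x.2.2)
    .id (.const _) ?_).of_eq fun v => ?_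
  · have ha : Primrec fun x : List (Fin 5) × Fin 5 × List (Fin 5) × List TGD => x.2.1 :=
      Primrec.fst.comp .snd
    have hl : Primrec fun x : List (Fin 5) × Fin 5 × List (Fin 5) × List TGD => x.2.2.1 :=
      Primrec.fst.comp (Primrec.snd.comp .snd)
    exact Primrec.list_cons.comp (primrec_write_tgd
      ((primrec_ctrl q).comp (Primrec.list_cons.comp ha hl)) ha ((primrec_ctrl q).comp hl))
      (Primrec.snd.comp (Primrec.snd.comp .snd))
  · induction v with
    | nil => rfl
    | cons a v ih => simp [writesOf, ih]

theorem primrec_genTGDs_queueProg [Fintype Q] (δ : Q → Fin 5 → Option (List (Fin 5) × Q))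
    (q₀ : Q) :
    Primrec fun n => genTGDs (queueProg δ q₀ (natWord n)) (ctrl (natWord n) q₀) := by
  refine (Primrec.list_cons.comp (primrec_startTGD.comp ((primrec_ctrl q₀).comp primrec_natWord))
    (Primrec.list_append.comp (.const ((coreProg δ).map Instr.tgd))
      ((primrec_writesOf q₀).comp primrec_natWord))).of_eq fun n => ?_
  simp [genTGDs, queueProg]

end Reduction

/-- Theorem 1(2): CQ-conservativity for linear TGDs is undecidable. -/
theorem cq_conservativity_linear_undecidable :
    ¬ ComputablePred (fun x : List TGD × List TGD × List RelSym × List RelSym =>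
        (∀ t ∈ x.1, t.wf ∧ t.Linear) ∧ (∀ t ∈ x.2.1, t.wf ∧ t.Linear) ∧
        CQConservative x.1 x.2.1 { r | r ∈ x.2.2.1 } { r | r ∈ x.2.2.2 }) := by
  intro H
  have hf : Partrec fun n => Nat.Partrec.Code.eval (Denumerable.ofNat Nat.Partrec.Code n) 0 :=
    Nat.Partrec.Code.eval_part.comp (Computable.ofNat _) (Computable.const 0)
  obtain ⟨Q, _, _, δ, q₀, hQ⟩ := exists_queue_automaton hf
  have hred : Primrec fun c : Nat.Partrec.Code =>
      (genTGDs (queueProg δ q₀ (natWord (Encodable.encode c)))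
        (ctrl (natWord (Encodable.encode c)) q₀), ladderTGDs, ([] : List RelSym), querySchema) :=
    ((primrec_genTGDs_queueProg δ q₀).comp Primrec.encode).pair (.const _)
  refine ComputablePred.halting_problem 0 ((ComputablePred.not
    (ComputablePred.computable_of_manyOneReducible ⟨_, hred.to_comp, fun _ => Iff.rfl⟩ H)).of_eq
    fun c => ?_)
  rw [and_iff_right (genTGDs_wf_linear _ _), and_iff_right ladderTGDs_wf_linear,
    cqConservative_genTGDs_iff, hQ, Denumerable.ofNat_encode, not_not]
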